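/- arXiv:1408.1866 — 4 statements merged into one kernel-verified Lean document; each statement's English description precedes it below -/
import Mathlib

section
/- Let (X, μ) be a median algebra and let ρ be a metric on X such that ρ(x,y) = ρ(x,z) + ρ(z,y) for all x, y, z ∈ X with z = μ(x,y,z). Then (X, ρ) is a median metric space and its intrinsic median operation μ_ρ coincides with μ. -/
/-- If `(X, μ)` is a median algebra and `ρ` (here: the metric of `X`) satisfies
`ρ(x,y) = ρ(x,z) + ρ(z,y)` whenever `z = μ(x,y,z)`, then `(X, ρ)` is a median metric space
whose intrinsic median operation coincides with `μ`: for every triple, the intersection of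
the three metric intervals is exactly `{μ x y z}`. -/
theorem stmt_0 {X : Type*} [MetricSpace X] (μ : X → X → X → X)
    (hsymm1 : ∀ x y z, μ x y z = μ x z y)
    (hsymm2 : ∀ x y z, μ x y z = μ y z x)
    (hmaj : ∀ x y, μ x x y = x)
    (hassoc : ∀ x y z u v, μ (μ x y z) u v = μ x (μ y u v) (μ z u v))
    (hadd : ∀ x y z, μ x y z = z → dist x y = dist x z + dist z y) :
    ∀ x y z : X,
      {w : X | dist x w + dist w y = dist x y} ∩
          {w : X | dist y w + dist w z = dist y z} ∩
          {w : X | dist z w + dist w x = dist z x} = {μ x y z} := by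
  have hmaj' : ∀ x y, μ x y x = x := fun x y => by rw [hsymm1, hmaj]
  have median_mem : ∀ x y z, μ x y (μ x y z) = μ x y z := fun x y z => by
    rw [hsymm2 x y z, hsymm2 y z x, ← hsymm2 (μ z x y) x y, hassoc, hmaj, hmaj']
  have dist_add : ∀ x y z, dist x (μ x y z) + dist (μ x y z) y = dist x y := fun x y z =>
    (hadd x y _ (median_mem x y z)).symm
  have eq_of_dist : ∀ x y w, dist x w + dist w y = dist x y → μ x y w = w := by
    intro x y w h
    have hx := dist_add x w y
    rw [hsymm1 x w y] at hx
    have hy := dist_add w y x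
    rw [← hsymm2 x w y, hsymm1 x w y] at hy
    have hxy := dist_add x y w
    rw [dist_comm w] at hy
    exact dist_le_zero.mp (by linarith)
  intro x y z
  ext w
  simp only [Set.mem_inter_iff, Set.mem_ofPred_eq, Set.mem_singleton_iff]
  constructor
  · rintro ⟨⟨hxy, hyz⟩, hzx⟩
    replace hxy := eq_of_dist x y w hxy
    replace hyz := eq_of_dist y z w hyz
    replace hzx := eq_of_dist z x w hzx
    have hy : μ y w (μ x y z) = w := by
      rw [← hsymm2 (μ x y z) y w, hassoc, hmaj, hsymm1 z y w, hsymm2 z w y, hsymm2 w y z,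
        hyz, hxy]
    have hx : μ x w (μ x y z) = w := by
      rw [← hsymm2 (μ x y z) x w, hsymm2 x y z, hassoc, hmaj, hzx,
        hsymm2 y w x, hsymm2 w x y, hxy]
    have h := hassoc x y (μ x y z) w (μ x y z)
    rw [median_mem, hmaj', hy, hx] at h
    exact h.symm
  · rintro rfl
    refine ⟨⟨dist_add x y z, ?_⟩, ?_⟩
    · rw [hsymm2 x y z]
      exact dist_add y z x
    · rw [← hsymm2 z x y]
      exact dist_add z x y
end

section
/- For every median algebra (M, μ) and every finite subset A ⊆ M, the subalgebra ⟨A⟩ generated by A is finite, with cardinality |⟨A⟩| ≤ 2^(2^|A|). -/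
/-- The laws of a median algebra, for a ternary operation `μ`. -/
structure IsMedian {M : Type*} (μ : M → M → M → M) : Prop where
  swap : ∀ x y z, μ x y z = μ x z y
  rotate : ∀ x y z, μ x y z = μ y z x
  majority : ∀ x y, μ x x y = x
  distrib : ∀ x y z u v, μ (μ x y z) u v = μ x (μ y u v) (μ z u v)

/-- A set is median-convex if it contains the median of any triple two of whose members it
contains. -/
def MedianConvex {M : Type*} (μ : M → M → M → M) (C : Set M) : Prop :=
  ∀ x ∈ C, ∀ y ∈ C, ∀ z, μ x y z ∈ C

/-- A halfspace is a convex set with convex complement. -/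
def MedianHalfspace {M : Type*} (μ : M → M → M → M) (H : Set M) : Prop :=
  MedianConvex μ H ∧ MedianConvex μ Hᶜ

namespace IsMedian


theorem swap_left {M : Type*} {μ : M → M → M → M} (h : IsMedian μ) (x y z : M) :
    μ x y z = μ y x z := by
  rw [h.rotate, h.swap]

theorem majority_right {M : Type*} {μ : M → M → M → M} (h : IsMedian μ) (x y : M) :
    μ y x x = x := by
  rw [h.rotate, h.majority]

theorem majority_outer {M : Type*} {μ : M → M → M → M} (h : IsMedian μ) (x y : M) :
    μ x y x = x := by
  rw [h.swap, h.majority]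

theorem distrib_last {M : Type*} {μ : M → M → M → M} (h : IsMedian μ) (x y z u v : M) :
    μ (μ x y z) u v = μ z (μ x u v) (μ y u v) := by
  rw [h.rotate x y z, h.rotate y z x, h.distrib]

/-- The median of `x`, `y`, `z` lies in the interval between `x` and `y`. -/
theorem median_mem_interval {M : Type*} {μ : M → M → M → M} (h : IsMedian μ) (x y z : M) :
    μ x y (μ x y z) = μ x y z := by
  rw [h.rotate x y (μ x y z), h.rotate y (μ x y z) x, h.distrib_last, h.majority,
    h.majority_outer, h.rotate z x y]

/-- If `b` lies between `c` and `x`, and `m` between `c` and `b`, then `b` lies between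
`m` and `x`. -/
theorem interval_shrink {M : Type*} {μ : M → M → M → M} (h : IsMedian μ) {b c m x : M}
    (hb : μ c x b = b) (hm : μ c b m = m) : μ m x b = b := by
  rw [← hm, h.distrib_last, hb, h.majority_outer, h.majority_right]

/-- If `p` lies between `c` and `x`, then `μ c x s` lies between `p` and `s`. -/
theorem median_mem_interval_of_mem {M : Type*} {μ : M → M → M → M} (h : IsMedian μ)
    {c x p : M} (hp : μ c x p = p) (s : M) : μ p s (μ c x s) = μ c x s := by
  have hc : μ c s (μ c x s) = μ c x s := by
    rw [h.swap c x s, h.median_mem_interval]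
  have hx : μ x s (μ c x s) = μ c x s := by
    rw [h.rotate c x s, h.median_mem_interval]
  conv_lhs => rw [← hp]
  rw [h.distrib_last, hc, hx, h.majority_right]

/-- The union of the intervals joining a point to a convex set is convex. -/
theorem medianConvex_join {M : Type*} {μ : M → M → M → M} (h : IsMedian μ) {C : Set M}
    (hC : MedianConvex μ C) (x : M) : MedianConvex μ {p | ∃ c ∈ C, μ c x p = p} := by
  rintro p ⟨c, hc, hp⟩ q ⟨d, hd, hq⟩ r
  refine ⟨μ c d (μ p q r), hC c hc d hd _, ?_⟩
  have hs := h.median_mem_interval p q r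
  set s := μ p q r
  have h₁ : μ (μ c x s) q s = s :=
    h.interval_shrink hs (h.median_mem_interval_of_mem hp s)
  rw [h.swap_left] at h₁
  have h₂ : μ (μ d x s) (μ c x s) s = s :=
    h.interval_shrink h₁ (h.median_mem_interval_of_mem hq s)
  rw [h.distrib_last, h.rotate, h.swap_left, h₂]

/-- If `b` lies between `c` and `x` and between `d` and `y`, then it lies between a point
of the interval joining `c` to `d` and any point of the interval joining `x` to `y`. -/
theorem interval_join {M : Type*} {μ : M → M → M → M} (h : IsMedian μ) {b c d x y : M}
    (hx : μ c x b = b) (hy : μ d y b = b) (w : M) : μ (μ c d b) (μ x y w) b = b := by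
  have h₁ : μ (μ c d b) x b = b :=
    h.interval_shrink hx (by rw [h.swap c d b, h.median_mem_interval])
  have h₂ : μ (μ c d b) y b = b :=
    h.interval_shrink hy (by rw [h.rotate c d b, h.median_mem_interval])
  rw [h.swap_left] at h₁ h₂ ⊢
  rw [h.distrib_last, h₁, h₂, h.majority_right]

/-- Distinct points are separated by a halfspace. -/
theorem exists_halfspace {M : Type*} {μ : M → M → M → M} (h : IsMedian μ) {a b : M}
    (hab : a ≠ b) : ∃ H, MedianHalfspace μ H ∧ a ∈ H ∧ b ∉ H := by
  have hchains : ∀ c ⊆ {C : Set M | MedianConvex μ C ∧ b ∉ C}, IsChain (· ⊆ ·) c → c.Nonempty →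
      ∃ ub ∈ {C : Set M | MedianConvex μ C ∧ b ∉ C}, ∀ s ∈ c, s ⊆ ub := by
    refine fun c hc hchain _ => ⟨⋃₀ c, ⟨?_, ?_⟩, fun s hs => Set.subset_sUnion_of_mem hs⟩
    · rintro x ⟨s, hs, hxs⟩ y ⟨t, ht, hyt⟩ z
      rcases hchain.total hs ht with hst | hts
      · exact ⟨t, ht, (hc ht).1 x (hst hxs) y hyt z⟩
      · exact ⟨s, hs, (hc hs).1 x hxs y (hts hyt) z⟩
    · rintro ⟨s, hs, hbs⟩
      exact (hc hs).2 hbs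
  obtain ⟨C, haC, hmax⟩ := zorn_subset_nonempty _ hchains {a}
    ⟨by rintro x rfl y rfl z; exact h.majority _ _, fun hb => hab hb.symm⟩
  obtain ⟨hC, hbC⟩ := hmax.prop
  have key : ∀ x ∉ C, ∃ c ∈ C, μ c x b = b := by
    intro x hx
    by_contra hb
    refine hx (hmax.le_of_ge (y := {p | ∃ c ∈ C, μ c x p = p})
      ⟨h.medianConvex_join hC x, hb⟩
      (fun c hc => ⟨c, hc, h.majority_outer c x⟩) ⟨a, haC rfl, h.majority_right x a⟩)
  refine ⟨C, ⟨hC, fun x hx y hy w hw => ?_⟩, haC rfl, hbC⟩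
  obtain ⟨c, hc, hcx⟩ := key x hx
  obtain ⟨d, hd, hdy⟩ := key y hy
  exact hbC (h.interval_join hcx hdy w ▸ hC _ (hC c hc d hd b) _ hw b)

end IsMedian

/-- Two halfspaces agree at a median if they agree at the three points. -/
theorem MedianHalfspace.median_mem_iff {M : Type*} {μ : M → M → M → M} (h : IsMedian μ)
    {H K : Set M} (hH : MedianHalfspace μ H) (hK : MedianHalfspace μ K) {x y z : M}
    (hx : x ∈ H ↔ x ∈ K) (hy : y ∈ H ↔ y ∈ K) (hz : z ∈ H ↔ z ∈ K) :
    μ x y z ∈ H ↔ μ x y z ∈ K := by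
  have vote : ∀ {L : Set M}, MedianHalfspace μ L →
      (μ x y z ∈ L ↔ x ∈ L ∧ y ∈ L ∨ y ∈ L ∧ z ∈ L ∨ x ∈ L ∧ z ∈ L) := by
    intro L hL
    have e₁ := h.rotate x y z
    have e₂ := h.swap x y z
    have p₁ := hL.1 x
    have p₂ := hL.1 y
    have n₁ := hL.2 x
    have n₂ := hL.2 y
    simp only [Set.mem_compl_iff] at n₁ n₂
    grind
  rw [vote hH, vote hK, hx, hy, hz]

theorem stmt_1 {M : Type*} (μ : M → M → M → M)
    (hsymm1 : ∀ x y z, μ x y z = μ x z y)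
    (hsymm2 : ∀ x y z, μ x y z = μ y z x)
    (hmaj : ∀ x y, μ x x y = x)
    (hassoc : ∀ x y z u v, μ (μ x y z) u v = μ x (μ y u v) (μ z u v))
    (A : Set M) (hA : A.Finite) :
    (⋂₀ {B : Set M | A ⊆ B ∧ ∀ a ∈ B, ∀ b ∈ B, ∀ c ∈ B, μ a b c ∈ B}).Finite ∧
      (⋂₀ {B : Set M | A ⊆ B ∧ ∀ a ∈ B, ∀ b ∈ B, ∀ c ∈ B, μ a b c ∈ B}).ncard ≤
        2 ^ (2 ^ A.ncard) := by
  have h : IsMedian μ := ⟨hsymm1, hsymm2, hmaj, hassoc⟩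
  set G := ⋂₀ {B : Set M | A ⊆ B ∧ ∀ a ∈ B, ∀ b ∈ B, ∀ c ∈ B, μ a b c ∈ B}
  let Φ : M → Set (Set M) := fun x => {S | ∃ H, MedianHalfspace μ H ∧ H ∩ A = S ∧ x ∈ H}
  have hfin : A.powerset.powerset.Finite := hA.powerset.powerset
  have hmaps : Set.MapsTo Φ G A.powerset.powerset := by
    rintro x - S ⟨H, -, rfl, -⟩
    exact Set.inter_subset_right
  have hinj : Set.InjOn Φ G := by
    intro x _ y hy hxy
    by_contra hne
    obtain ⟨H, hH, hxH, hyH⟩ := h.exists_halfspace hne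
    have hS : H ∩ A ∈ Φ y := hxy ▸ ⟨H, hH, rfl, hxH⟩
    obtain ⟨K, hK, hKA, hyK⟩ := hS
    have hagree : y ∈ {z | z ∈ H ↔ z ∈ K} := by
      refine hy _ ⟨fun z hz => ?_, fun a ha b hb c hc =>
        MedianHalfspace.median_mem_iff h hH hK ha hb hc⟩
      have := Set.ext_iff.1 hKA z
      simp only [Set.mem_inter_iff, hz, and_true] at this
      exact this.symm
    exact hyH (hagree.2 hyK)
  refine ⟨Set.Finite.of_injOn hmaps hinj hfin, ?_⟩
  calc G.ncard ≤ A.powerset.powerset.ncard :=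
        Set.ncard_le_ncard_of_injOn Φ hmaps hinj hfin
    _ = 2 ^ (2 ^ A.ncard) := by
        rw [Set.ncard_powerset _ hA.powerset, Set.ncard_powerset _ hA]
end

section
/- Let (M, μ) be a finite median algebra and let l : 𝒲(M) → ℝ_{>0} be any function on its set of walls. Define d_l(a,b) = Σ_{W ∈ 𝒲(a|b)} l(W) for a, b ∈ M. Then d_l is a metric on M and (M, d_l) is a median metric space whose intrinsic median operation equals μ. -/
/-- A subset of a median algebra is convex if it contains the interval
`I(a,b) = {z | μ a b z = z}` between any two of its points. -/
def MedConvex {M : Type*} (μ : M → M → M → M) (h : Set M) : Prop :=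
  ∀ a ∈ h, ∀ b ∈ h, ∀ z : M, μ a b z = z → z ∈ h

/-- A halfspace of a median algebra: one side of a wall, i.e. a nonempty convex set with
nonempty convex complement.  Walls `{h, hᶜ}` correspond to (unordered) pairs of
complementary halfspaces. -/
def IsHalfspace {M : Type*} (μ : M → M → M → M) (h : Set M) : Prop :=
  h.Nonempty ∧ hᶜ.Nonempty ∧ MedConvex μ h ∧ MedConvex μ hᶜ

/-- `d_l(a,b) = Σ_{W ∈ 𝒲(a|b)} l(W)`: each wall separating `a` from `b` is represented by
its unique halfspace containing `a` and not `b`. -/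
noncomputable def dl {M : Type*} (μ : M → M → M → M) (l : Set M → ℝ) (a b : M) : ℝ :=
  ∑ᶠ h ∈ {h : Set M | IsHalfspace μ h ∧ a ∈ h ∧ b ∉ h}, l h

/-- Both sides of a wall are halfspaces. -/
theorem IsHalfspace.compl {M : Type*} {μ : M → M → M → M} {h : Set M}
    (hh : IsHalfspace μ h) : IsHalfspace μ hᶜ := by
  obtain ⟨h1, h2, h3, h4⟩ := hh
  exact ⟨h2, by rwa [compl_compl], h4, by rwa [compl_compl]⟩

/-- Distinct points of a finite median algebra are separated by a wall. -/
theorem exists_isHalfspace_mem_notMem {M : Type*} [Finite M] {μ : M → M → M → M}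
    (hsymm1 : ∀ x y z, μ x y z = μ x z y)
    (hsymm2 : ∀ x y z, μ x y z = μ y z x)
    (hmaj : ∀ x y, μ x x y = x)
    (hassoc : ∀ x y z u v, μ (μ x y z) u v = μ x (μ y u v) (μ z u v))
    {a b : M} (hab : a ≠ b) : ∃ h, IsHalfspace μ h ∧ a ∈ h ∧ b ∉ h := by
  have le_trans' : ∀ x y z, μ a x y = x → μ a y z = y → μ a x z = x := by
    intro x y z hxy hyz
    have h1 := hassoc x a y a z
    grind
  let r : M → M → Prop := fun x y => μ a x y = x ∧ x ≠ y
  have : IsTrans M r := ⟨by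
    rintro x y z ⟨h1, h2⟩ ⟨h3, h4⟩
    refine ⟨le_trans' x y z h1 h3, ?_⟩
    rintro rfl
    exact h2 (by rw [← h1, hsymm1, h3])⟩
  have : Std.Irrefl r := ⟨fun x h => h.2 rfl⟩
  obtain ⟨c, ⟨hcb, hca⟩, hmin⟩ := (Finite.wellFounded_of_trans_of_irrefl r).has_min
    {c | μ a c b = c ∧ c ≠ a} ⟨b, by grind, hab.symm⟩
  have hval : ∀ x, μ a c x = a ∨ μ a c x = c := by
    intro x
    by_contra! hx
    have hle : μ a (μ a c x) c = μ a c x := by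
      have h1 := hassoc x a c a c
      grind
    exact hmin _ ⟨le_trans' _ _ _ hle hcb, hx.1⟩ ⟨hle, hx.2⟩
  have hconv : ∀ t, MedConvex μ {x | μ a c x = t} := by
    intro t x hx y hy z hz
    simp only [Set.mem_ofPred_eq] at hx hy ⊢
    have h1 := hassoc z x y a c
    grind
  have hb : μ a c b ≠ a := by rwa [hcb]
  refine ⟨{x | μ a c x = a}, ⟨⟨a, by simp only [Set.mem_ofPred_eq]; grind⟩, ⟨b, hb⟩,
    hconv a, ?_⟩, by simp only [Set.mem_ofPred_eq]; grind, hb⟩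
  convert hconv c using 1
  ext x
  simp only [Set.mem_compl_iff, Set.mem_ofPred_eq]
  grind

open Classical in
theorem dl_eq_sum {M : Type*} [Fintype (Set M)] (μ : M → M → M → M) (l : Set M → ℝ) (a b : M) :
    dl μ l a b = ∑ h : Set M, if IsHalfspace μ h ∧ a ∈ h ∧ b ∉ h then l h else 0 := by
  rw [dl, finsum_mem_def, finsum_eq_sum_of_fintype]
  simp only [Set.indicator_apply, Set.mem_ofPred_eq]

theorem dl_comm {M : Type*} [Finite M] {μ : M → M → M → M} {l : Set M → ℝ}
    (hlsymm : ∀ h : Set M, l hᶜ = l h) (a b : M) : dl μ l a b = dl μ l b a := by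
  classical
  have := Fintype.ofFinite (Set M)
  rw [dl_eq_sum, dl_eq_sum]
  refine Fintype.sum_equiv (Equiv.ofBijective compl compl_bijective) _ _ fun h => ?_
  have hiff : IsHalfspace μ hᶜ ↔ IsHalfspace μ h :=
    ⟨fun hh => by simpa using hh.compl, fun hh => hh.compl⟩
  simp only [Equiv.ofBijective_apply, hiff, hlsymm, Set.mem_compl_iff, not_not,
    and_comm (a := a ∈ h)]

theorem dl_eq_zero_iff {M : Type*} [Finite M] {μ : M → M → M → M} {l : Set M → ℝ}
    (hpos : ∀ h : Set M, IsHalfspace μ h → 0 < l h) (a b : M) :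
    dl μ l a b = 0 ↔ ∀ h, IsHalfspace μ h → a ∈ h → b ∈ h := by
  classical
  have := Fintype.ofFinite (Set M)
  rw [dl_eq_sum, Finset.sum_eq_zero_iff_of_nonneg]
  · refine forall_congr' fun h => ?_
    have := hpos h
    grind
  · intro h _
    have := hpos h
    grind

theorem dl_triangle {M : Type*} [Finite M] {μ : M → M → M → M} {l : Set M → ℝ}
    (hpos : ∀ h : Set M, IsHalfspace μ h → 0 < l h) (a b c : M) :
    dl μ l a c ≤ dl μ l a b + dl μ l b c := by
  classical
  have := Fintype.ofFinite (Set M)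
  simp only [dl_eq_sum, ← Finset.sum_add_distrib]
  refine Finset.sum_le_sum fun h _ => ?_
  have := hpos h
  grind

/-- A point lies in a metric interval iff it lies in every halfspace containing both endpoints. -/
theorem dl_add_eq_iff {M : Type*} [Finite M] {μ : M → M → M → M} {l : Set M → ℝ}
    (hpos : ∀ h : Set M, IsHalfspace μ h → 0 < l h) (x y w : M) :
    dl μ l x w + dl μ l w y = dl μ l x y ↔
      ∀ h, IsHalfspace μ h → x ∈ h → y ∈ h → w ∈ h := by
  classical
  have := Fintype.ofFinite (Set M)
  simp only [dl_eq_sum, ← Finset.sum_add_distrib]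
  rw [eq_comm, Finset.sum_eq_sum_iff_of_le]
  · constructor
    · intro H h hh hx hy
      have h1 := H h (Finset.mem_univ _)
      have h2 := hpos h
      grind
    · intro H h _
      have h1 := H h
      have h2 : IsHalfspace μ h → x ∉ h → y ∉ h → w ∉ h := fun hh => H hᶜ hh.compl
      grind
  · intro h _
    have := hpos h
    grind

/-- Let `(M, μ)` be a finite median algebra and `l` a positive function on its
walls (represented as a function on halfspaces taking the same value on complementary
halfspaces).  Then `d_l` is a metric on `M` and `(M, d_l)` is a median metric space whose
intrinsic median operation equals `μ`. -/
theorem stmt_2 {M : Type*} [Finite M] (μ : M → M → M → M)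
    (hsymm1 : ∀ x y z, μ x y z = μ x z y)
    (hsymm2 : ∀ x y z, μ x y z = μ y z x)
    (hmaj : ∀ x y, μ x x y = x)
    (hassoc : ∀ x y z u v, μ (μ x y z) u v = μ x (μ y u v) (μ z u v))
    (l : Set M → ℝ) (hpos : ∀ h : Set M, IsHalfspace μ h → 0 < l h)
    (hlsymm : ∀ h : Set M, l hᶜ = l h) :
    (∀ a b : M, dl μ l a b = dl μ l b a) ∧
      (∀ a b : M, dl μ l a b = 0 ↔ a = b) ∧
      (∀ a b c : M, dl μ l a c ≤ dl μ l a b + dl μ l b c) ∧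
      ∀ x y z : M,
        {w : M | dl μ l x w + dl μ l w y = dl μ l x y} ∩
            {w : M | dl μ l y w + dl μ l w z = dl μ l y z} ∩
            {w : M | dl μ l z w + dl μ l w x = dl μ l z x} = {μ x y z} := by
  have sep : ∀ a b : M, (∀ h, IsHalfspace μ h → a ∈ h → b ∈ h) → a = b := by
    intro a b H
    by_contra hab
    obtain ⟨h, hh, ha, hb⟩ :=
      exists_isHalfspace_mem_notMem hsymm1 hsymm2 hmaj hassoc hab
    exact hb (H h hh ha)
  refine ⟨dl_comm hlsymm, fun a b => ?_, dl_triangle hpos, fun x y z => ?_⟩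
  · rw [dl_eq_zero_iff hpos]
    exact ⟨sep a b, by rintro rfl; exact fun _ _ h => h⟩
  have hmem : ∀ x y z h, IsHalfspace μ h → x ∈ h → y ∈ h → μ x y z ∈ h := by
    intro x y z h hh hx hy
    refine hh.2.2.1 x hx y hy _ ?_
    have h1 := hassoc z x y x y
    grind
  ext w
  simp only [Set.mem_inter_iff, Set.mem_ofPred_eq, Set.mem_singleton_iff, dl_add_eq_iff hpos]
  constructor
  · rintro ⟨⟨h1, h2⟩, h3⟩
    refine (sep _ _ fun h hh hm => ?_).symm
    by_contra hw
    have k1 := hmem x y z hᶜ hh.compl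
    have k2 := hmem y z x hᶜ hh.compl
    have k3 := hmem z x y hᶜ hh.compl
    rw [← hsymm2 x y z] at k2
    rw [hsymm2 z x y] at k3
    have := h1 h hh
    have := h2 h hh
    have := h3 h hh
    simp only [Set.mem_compl_iff] at k1 k2 k3
    tauto
  · rintro rfl
    refine ⟨⟨fun h hh => hmem x y z h hh, fun h hh => ?_⟩, fun h hh => ?_⟩
    · rw [hsymm2]
      exact hmem y z x h hh
    · rw [← hsymm2]
      exact hmem z x y h hh
end

section
/- Let (X, d, μ) be a metric median algebra and let M ⊆ N be finite subalgebras of (X, μ). Then d_μ^M(x,y) ≤ d_μ^N(x,y) for all x, y ∈ X. -/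
/-- The axioms of a median algebra for a ternary operation. -/
def IsMedianFn {X : Type*} (μ : X → X → X → X) : Prop :=
  (∀ x y z, μ x y z = μ x z y) ∧ (∀ x y z, μ x y z = μ y z x) ∧
    (∀ x y, μ x x y = x) ∧
    ∀ x y z u v, μ (μ x y z) u v = μ x (μ y u v) (μ z u v)

/-- A subset closed under the median operation. -/
def IsSubalgebra {X : Type*} (μ : X → X → X → X) (M : Set X) : Prop :=
  ∀ a ∈ M, ∀ b ∈ M, ∀ c ∈ M, μ a b c ∈ M

/-- `h` is convex in the subalgebra `M`: it contains `I(a,b) ∩ M` for all `a, b ∈ h`. -/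
def ConvexIn {X : Type*} (μ : X → X → X → X) (M h : Set X) : Prop :=
  ∀ a ∈ h, ∀ b ∈ h, ∀ z ∈ M, μ a b z = z → z ∈ h

/-- A halfspace of the subalgebra `M`: one side of a wall of `M`, i.e. a nonempty convex
subset of `M` with nonempty convex complement `M \ h`.  Walls of `M` correspond to
(unordered) pairs `{h, M \ h}` of complementary halfspaces. -/
def IsHalfspaceIn {X : Type*} (μ : X → X → X → X) (M h : Set X) : Prop :=
  h ⊆ M ∧ h.Nonempty ∧ (M \ h).Nonempty ∧ ConvexIn μ M h ∧ ConvexIn μ M (M \ h)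

/-- `a` and `b` are adjacent (form an edge) in `M` if exactly one wall of `M` separates
them; separating walls are represented by the halfspace containing `a` and not `b`. -/
def AdjacentIn {X : Type*} (μ : X → X → X → X) (M : Set X) (a b : X) : Prop :=
  a ∈ M ∧ b ∈ M ∧ ∃! h : Set X, IsHalfspaceIn μ M h ∧ a ∈ h ∧ b ∉ h

/-- `λ_max^M(W)` for the wall `W = {h, M \ h}`: the maximal length `d(a,b)` of an edge
`{a,b}` of `M` crossing the wall. -/
noncomputable def lamMax {X : Type*} [MetricSpace X] (μ : X → X → X → X) (M h : Set X) : ℝ :=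
  sSup {r : ℝ | ∃ a b, AdjacentIn μ M a b ∧ a ∈ h ∧ b ∈ M \ h ∧ r = dist a b}

/-- `d_μ^M(x,y) = Σ_{W ∈ 𝒲^M(x|y)} λ_max^M(W)` if `x, y ∈ M` and `0` otherwise; the walls
separating `x` from `y` are represented by their halfspaces containing `x` and not `y`. -/
noncomputable def dmuM {X : Type*} [MetricSpace X] (μ : X → X → X → X) (M : Set X)
    (x y : X) : ℝ :=
  ∑ᶠ h ∈ {h : Set X | IsHalfspaceIn μ M h ∧ x ∈ h ∧ y ∈ M \ h}, lamMax μ M h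

namespace IsMedianFn

variable {X : Type*} {μ : X → X → X → X}

theorem swap_right (hμ : IsMedianFn μ) (x y z : X) : μ x y z = μ x z y := hμ.1 x y z

theorem rotate (hμ : IsMedianFn μ) (x y z : X) : μ x y z = μ y z x := hμ.2.1 x y z

theorem swap_left (hμ : IsMedianFn μ) (x y z : X) : μ x y z = μ y x z := by
  rw [hμ.rotate x y z, hμ.swap_right y z x]

theorem left_self (hμ : IsMedianFn μ) (x y : X) : μ x x y = x := hμ.2.2.1 x y

theorem right_self (hμ : IsMedianFn μ) (x y : X) : μ x y y = y := by
  rw [hμ.rotate, hμ.left_self]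

theorem outer_self (hμ : IsMedianFn μ) (x y : X) : μ x y x = x := by
  rw [hμ.swap_right, hμ.left_self]

theorem distrib (hμ : IsMedianFn μ) (a b u v z : X) :
    μ a b (μ u v z) = μ (μ a b u) (μ a b v) z := by
  have h := hμ.2.2.2 z u v a b
  rw [hμ.rotate a b (μ u v z), hμ.rotate b (μ u v z) a, ← hμ.rotate z u v, h,
    hμ.rotate z, ← hμ.rotate a b u |>.trans (hμ.rotate b u a),
    ← hμ.rotate a b v |>.trans (hμ.rotate b v a)]

/-- Projecting onto an interval is idempotent. -/
theorem proj_proj (hμ : IsMedianFn μ) (a b z : X) : μ a b (μ a b z) = μ a b z := by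
  rw [hμ.distrib, hμ.outer_self, hμ.right_self]

/-- The median of `a`, `b`, `z` lies in the interval between `a` and `z`. -/
theorem median_mem_left (hμ : IsMedianFn μ) (a b z : X) : μ a z (μ a b z) = μ a b z := by
  rw [hμ.swap_right a b z, hμ.proj_proj]

/-- The median of `a`, `b`, `z` lies in the interval between `b` and `z`. -/
theorem median_mem_right (hμ : IsMedianFn μ) (a b z : X) : μ b z (μ a b z) = μ a b z := by
  rw [hμ.rotate a b z, hμ.proj_proj]

theorem interval_symm (hμ : IsMedianFn μ) {a b c : X} (h : μ a b c = c) : μ b a c = c := by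
  rw [hμ.swap_left, h]

theorem interval_trans (hμ : IsMedianFn μ) {a b c z : X} (hc : μ a b c = c)
    (hz : μ a c z = z) : μ a b z = z := by
  conv_lhs => rw [← hz]
  rw [hμ.distrib, hc, hμ.outer_self, hz]

theorem interval_antisymm (hμ : IsMedianFn μ) {a b c : X} (hc : μ a b c = c)
    (hb : μ a c b = b) : b = c := by
  rw [← hb, hμ.swap_right, hc]

end IsMedianFn

section Walls

variable {X : Type*} {μ : X → X → X → X} {M N : Set X}

/-- Halfspaces of `M` containing `x` but not `y`. -/
def separatingHalfspaces (μ : X → X → X → X) (M : Set X) (x y : X) : Set (Set X) :=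
  {h | IsHalfspaceIn μ M h ∧ x ∈ h ∧ y ∈ M \ h}

theorem finite_separatingHalfspaces (hM : M.Finite) (x y : X) :
    (separatingHalfspaces μ M x y).Finite :=
  hM.finite_subsets.subset fun _ hh => hh.1.1

/-- If no element of `N` lies strictly between `a` and `b`, the points projecting to `a` in the
interval between `a` and `b` form a halfspace. -/
theorem isHalfspaceIn_projection (hμ : IsMedianFn μ) (hN : IsSubalgebra μ N) {a b : X}
    (ha : a ∈ N) (hb : b ∈ N) (hab : a ≠ b)
    (hI : ∀ c ∈ N, μ a b c = c → c = a ∨ c = b) :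
    IsHalfspaceIn μ N {z ∈ N | μ a b z = a} := by
  have hproj : ∀ z ∈ N, μ a b z = a ∨ μ a b z = b := fun z hz =>
    hI _ (hN a ha b hb z hz) (hμ.proj_proj a b z)
  refine ⟨fun z hz => hz.1, ⟨a, ha, hμ.outer_self a b⟩,
    ⟨b, hb, fun h => hab (h.2.symm.trans (hμ.right_self a b))⟩, ?_, ?_⟩
  · rintro u ⟨-, hu⟩ v ⟨-, hv⟩ z hz huvz
    refine ⟨hz, ?_⟩
    rw [← huvz, hμ.distrib, hu, hv, hμ.left_self]
  · rintro u ⟨huN, hu⟩ v ⟨hvN, hv⟩ z hz huvz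
    refine ⟨hz, fun h => hab ?_⟩
    have hu' := (hproj u huN).resolve_left fun h => hu ⟨huN, h⟩
    have hv' := (hproj v hvN).resolve_left fun h => hv ⟨hvN, h⟩
    rw [← h.2, ← huvz, hμ.distrib, hu', hv', hμ.left_self]

theorem IsHalfspaceIn.eq_projection (hμ : IsMedianFn μ) (hN : IsSubalgebra μ N) {a b : X}
    (ha : a ∈ N) (hb : b ∈ N) (hI : ∀ c ∈ N, μ a b c = c → c = a ∨ c = b)
    {h : Set X} (hh : IsHalfspaceIn μ N h) (hah : a ∈ h) (hbh : b ∉ h) :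
    h = {z ∈ N | μ a b z = a} := by
  obtain ⟨hsub, -, -, hconv, hconv'⟩ := hh
  ext z
  refine ⟨fun hz => ⟨hsub hz, ?_⟩, fun ⟨hzN, hz⟩ => ?_⟩
  · have hzN := hsub hz
    have hmN := hN a ha b hb z hzN
    refine (hI _ hmN (hμ.proj_proj a b z)).resolve_right fun h => hbh ?_
    rw [← h]
    exact hconv a hah z hz _ hmN (hμ.median_mem_left a b z)
  · by_contra hzh
    have hm := hconv' b ⟨hb, hbh⟩ z ⟨hzN, hzh⟩ _ (hN a ha b hb z hzN)
      (hμ.median_mem_right a b z)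
    rw [hz] at hm
    exact hm.2 hah

theorem separatingHalfspaces_eq_union {a b c : X} (ha : a ∈ N)
    (hb : b ∈ N) (hc : c ∈ N) (habc : μ a b c = c) :
    separatingHalfspaces μ N a b =
      separatingHalfspaces μ N a c ∪ separatingHalfspaces μ N c b := by
  ext h
  constructor
  · rintro ⟨hh, hah, hbh⟩
    by_cases hch : c ∈ h
    · exact Or.inr ⟨hh, hch, hbh⟩
    · exact Or.inl ⟨hh, hah, hc, hch⟩
  · rintro (⟨hh, hah, hch⟩ | ⟨hh, hch, hbh⟩)
    · exact ⟨hh, hah, hb, fun hbh => hch.2 (hh.2.2.2.1 a hah b hbh c hc habc)⟩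
    · refine ⟨hh, ?_, hbh⟩
      by_contra hah
      exact (hh.2.2.2.2 a ⟨ha, hah⟩ b hbh c hc habc).2 hch

theorem disjoint_separatingHalfspaces (a b c : X) :
    Disjoint (separatingHalfspaces μ N a c) (separatingHalfspaces μ N c b) :=
  Set.disjoint_left.2 fun _ h h' => h.2.2.2 h'.2.1

/-- A halfspace of `N` separating two points of a subset `M` restricts to a halfspace of `M`. -/
theorem IsHalfspaceIn.inter (hMN : M ⊆ N) {k : Set X} (hk : IsHalfspaceIn μ N k) {x y : X}
    (hx : x ∈ M) (hy : y ∈ M) (hxk : x ∈ k) (hyk : y ∉ k) : IsHalfspaceIn μ M (k ∩ M) := by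
  refine ⟨Set.inter_subset_right, ⟨x, hxk, hx⟩, ⟨y, hy, fun h => hyk h.1⟩, ?_, ?_⟩
  · intro a ha b hb z hz h
    exact ⟨hk.2.2.2.1 a ha.1 b hb.1 z (hMN hz) h, hz⟩
  · intro a ha b hb z hz h
    exact ⟨hz, fun hzk => (hk.2.2.2.2 a ⟨hMN ha.1, fun h => ha.2 ⟨h, ha.1⟩⟩
      b ⟨hMN hb.1, fun h => hb.2 ⟨h, hb.1⟩⟩ z (hMN hz) h).2 hzk.1⟩

end Walls

section Metric

variable {X : Type*} [MetricSpace X] {μ : X → X → X → X} {M N : Set X}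

theorem lamMax_nonneg (M h : Set X) : 0 ≤ lamMax μ M h := by
  refine Real.sSup_nonneg ?_
  rintro r ⟨a, b, -, -, -, rfl⟩
  exact dist_nonneg

theorem AdjacentIn.dist_le_lamMax (hM : M.Finite) {a b : X} (hab : AdjacentIn μ M a b)
    {h : Set X} (ha : a ∈ h) (hb : b ∉ h) : dist a b ≤ lamMax μ M h := by
  refine le_csSup (Set.Finite.bddAbove ?_) ⟨a, b, hab, ha, ⟨hab.2.1, hb⟩, rfl⟩
  refine ((hM.prod hM).image fun p => dist p.1 p.2).subset ?_
  rintro r ⟨a, b, hab, -, -, rfl⟩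
  exact ⟨(a, b), ⟨hab.1, hab.2.1⟩, rfl⟩

theorem dmuM_nonneg (M : Set X) (x y : X) : 0 ≤ dmuM μ M x y :=
  finsum_mem_induction (0 ≤ ·) le_rfl (fun _ _ => add_nonneg) fun h _ => lamMax_nonneg M h

theorem dmuM_add_of_mem_interval (hN : N.Finite) {a b c : X} (ha : a ∈ N)
    (hb : b ∈ N) (hc : c ∈ N) (habc : μ a b c = c) :
    dmuM μ N a b = dmuM μ N a c + dmuM μ N c b := by
  have h := finsum_mem_union (f := lamMax μ N)
    (disjoint_separatingHalfspaces (μ := μ) (N := N) a b c)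
    (finite_separatingHalfspaces hN a c) (finite_separatingHalfspaces hN c b)
  rw [← separatingHalfspaces_eq_union ha hb hc habc] at h
  exact h

/-- On a finite subalgebra, the wall metric dominates the original metric. -/
theorem dist_le_dmuM (hμ : IsMedianFn μ) (hNfin : N.Finite) (hN : IsSubalgebra μ N) {a b : X}
    (ha : a ∈ N) (hb : b ∈ N) : dist a b ≤ dmuM μ N a b := by
  induction hn : {z ∈ N | μ a b z = z}.ncard using Nat.strong_induction_on generalizing a b with
  | _ n ih =>
    have hfin : {z ∈ N | μ a b z = z}.Finite := hNfin.subset fun z hz => hz.1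
    rcases eq_or_ne a b with rfl | hab
    · rw [dist_self]
      exact dmuM_nonneg N a a
    by_cases hI : ∀ c ∈ N, μ a b c = c → c = a ∨ c = b
    · have hh := isHalfspaceIn_projection hμ hN ha hb hab hI
      have hah : a ∈ {z ∈ N | μ a b z = a} := ⟨ha, hμ.outer_self a b⟩
      have hbh : b ∉ {z ∈ N | μ a b z = a} := fun h => hab (h.2.symm.trans (hμ.right_self a b))
      have huniq := fun h (hh : IsHalfspaceIn μ N h) => hh.eq_projection hμ hN ha hb hI
      have hadj : AdjacentIn μ N a b :=
        ⟨ha, hb, _, ⟨hh, hah, hbh⟩, fun h h' => huniq h h'.1 h'.2.1 h'.2.2⟩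
      have hsep : {h : Set X | IsHalfspaceIn μ N h ∧ a ∈ h ∧ b ∈ N \ h} =
          {{z ∈ N | μ a b z = a}} := by
        ext h
        refine ⟨fun h' => huniq h h'.1 h'.2.1 h'.2.2.2, ?_⟩
        rintro rfl
        exact ⟨hh, hah, hb, hbh⟩
      rw [dmuM, hsep, finsum_mem_singleton]
      exact hadj.dist_le_lamMax hNfin hah hbh
    · push Not at hI
      obtain ⟨c, hc, habc, hca, hcb⟩ := hI
      have hac : dist a c ≤ dmuM μ N a c := by
        refine ih _ ?_ ha hc rfl
        rw [← hn]
        refine Set.ncard_lt_ncard ⟨fun z hz => ⟨hz.1, hμ.interval_trans habc hz.2⟩, fun h => ?_⟩ hfin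
        exact hcb (hμ.interval_antisymm habc (h ⟨hb, hμ.right_self a b⟩).2).symm
      have hcb' : dist c b ≤ dmuM μ N c b := by
        refine ih _ ?_ hc hb rfl
        rw [← hn]
        have hbac := hμ.interval_symm habc
        refine Set.ncard_lt_ncard ⟨fun z hz => ⟨hz.1, hμ.interval_symm
          (hμ.interval_trans hbac (hμ.interval_symm hz.2))⟩, fun h => ?_⟩ hfin
        exact hca (hμ.interval_antisymm hbac
          (hμ.interval_symm (h ⟨ha, hμ.outer_self a b⟩).2)).symm
      rw [dmuM_add_of_mem_interval hNfin ha hb hc habc]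
      exact (dist_triangle a c b).trans (add_le_add hac hcb')

theorem dmuM_eq_sum (hM : M.Finite) (x y : X) :
    dmuM μ M x y = ∑ h ∈ (finite_separatingHalfspaces (μ := μ) hM x y).toFinset, lamMax μ M h :=
  finsum_mem_eq_finite_toFinset_sum _ _

end Metric

/-- In a metric median algebra `(X, d, μ)`, for finite subalgebras `M ⊆ N`
one has `d_μ^M(x,y) ≤ d_μ^N(x,y)` for all `x, y ∈ X`. -/
theorem stmt_3 {X : Type*} [MetricSpace X] (μ : X → X → X → X)
    (hmed : IsMedianFn μ)
    (hcont : Continuous fun p : X × X × X => μ p.1 p.2.1 p.2.2)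
    (M N : Set X) (hMfin : M.Finite) (hNfin : N.Finite)
    (hMsub : IsSubalgebra μ M) (hNsub : IsSubalgebra μ N) (hMN : M ⊆ N)
    (x y : X) : dmuM μ M x y ≤ dmuM μ N x y := by
  classical
  by_cases hxy : x ∈ M ∧ y ∈ M
  swap
  · have hempty : {h : Set X | IsHalfspaceIn μ M h ∧ x ∈ h ∧ y ∈ M \ h} = ∅ :=
      Set.eq_empty_of_forall_notMem fun h hh => hxy ⟨hh.1.1 hh.2.1, hh.2.2.1⟩
    rw [dmuM, hempty, finsum_mem_empty]
    exact dmuM_nonneg N x y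
  obtain ⟨hx, hy⟩ := hxy
  rw [dmuM_eq_sum hMfin, dmuM_eq_sum hNfin]
  have hmaps : ∀ k ∈ (finite_separatingHalfspaces (μ := μ) hNfin x y).toFinset,
      k ∩ M ∈ (finite_separatingHalfspaces (μ := μ) hMfin x y).toFinset := by
    intro k hk
    obtain ⟨hk, hxk, hyk⟩ := (Set.Finite.mem_toFinset _).1 hk
    exact (Set.Finite.mem_toFinset _).2
      ⟨hk.inter hMN hx hy hxk hyk.2, ⟨hxk, hx⟩, hy, fun h => hyk.2 h.1⟩
  rw [← Finset.sum_fiberwise_of_maps_to hmaps]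
  refine Finset.sum_le_sum fun h hh => ?_
  obtain ⟨hh, hxh, hyh⟩ := (Set.Finite.mem_toFinset _).1 hh
  refine Real.sSup_le ?_ (Finset.sum_nonneg fun k _ => lamMax_nonneg N k)
  rintro r ⟨a, b, ⟨ha, hb, huniq⟩, hah, hbh, rfl⟩
  refine (dist_le_dmuM hmed hNfin hNsub (hMN ha) (hMN hb)).trans ?_
  rw [dmuM_eq_sum hNfin]
  refine Finset.sum_le_sum_of_subset_of_nonneg (fun k hk => ?_) fun k _ _ => lamMax_nonneg N k
  obtain ⟨hk, hak, hbk⟩ := (Set.Finite.mem_toFinset _).1 hk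
  have hkh : k ∩ M = h := huniq.unique
    ⟨hk.inter hMN ha hb hak hbk.2, ⟨hak, ha⟩, fun h => hbk.2 h.1⟩ ⟨hh, hah, hbh.2⟩
  refine Finset.mem_filter.2 ⟨(Set.Finite.mem_toFinset _).2 ⟨hk, ?_, hMN hy, fun hyk => ?_⟩, hkh⟩
  · exact (hkh.symm ▸ hxh : x ∈ k ∩ M).1
  · exact hyh.2 (hkh ▸ ⟨hyk, hy⟩)
end
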